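/- arXiv:2009.05314 — 2 statements merged into one kernel-verified Lean document; each statement's English description precedes it below -/
import Mathlib

section
/- For every real number n with n ≥ 2 and every natural number k, one has (logb 2 n)^(k+1) ≥ (logb 2 n)^k + (logb 2 (n/2))^(k+1). -/
theorem stmt_1 (n : ℝ) (hn : n ≥ 2) (k : ℕ) :
    (Real.logb 2 n) ^ (k + 1) ≥ (Real.logb 2 n) ^ k + (Real.logb 2 (n / 2)) ^ (k + 1) := by
  have hhalf : Real.logb 2 (n / 2) = Real.logb 2 n - 1 := by
    rw [Real.logb_div (by linarith) (by norm_num), Real.logb_self_eq_one (by norm_num)]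
  have hone : 1 ≤ Real.logb 2 n := by
    rw [Real.le_logb_iff_rpow_le (by norm_num) (by linarith)]
    simpa using hn
  rw [hhalf]
  generalize Real.logb 2 n = x at hone
  have hpow : (x - 1) ^ k ≤ x ^ k := pow_le_pow_left₀ (by linarith) (by linarith) k
  have hmul := mul_le_mul_of_nonneg_right hpow (sub_nonneg.2 hone)
  rw [pow_succ, pow_succ]
  linarith
end

section
/- Let f : ℕ → ℝ, let c be a nonnegative real number, and let k be a natural number. Suppose that for every natural number n ≥ 2, f n ≤ c · (logb 2 n)^k + f (n / 2), where n / 2 is natural-number floor division. Then for every n ≥ 1, f n ≤ f 1 + c · (logb 2 n)^(k+1). -/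
theorem logb_two_nat_div_two_le {n : ℕ} (hn : 2 ≤ n) :
    Real.logb 2 (n / 2 : ℕ) ≤ Real.logb 2 n - 1 := by
  have hpos : (0 : ℝ) < (n / 2 : ℕ) := by
    exact_mod_cast Nat.div_pos hn two_pos
  have hn0 : (n : ℝ) ≠ 0 := by
    exact_mod_cast (by omega : n ≠ 0)
  calc Real.logb 2 (n / 2 : ℕ) ≤ Real.logb 2 ((n : ℝ) / 2) :=
        Real.logb_le_logb_of_le one_lt_two hpos (by exact_mod_cast Nat.cast_div_le)
    _ = Real.logb 2 n - 1 := by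
        rw [Real.logb_div hn0 two_ne_zero, Real.logb_self_eq_one one_lt_two]

theorem pow_add_pow_succ_le {x y : ℝ} (hx : 0 ≤ x) (hxy : x ≤ y - 1) (k : ℕ) :
    y ^ k + x ^ (k + 1) ≤ y ^ (k + 1) := by
  have hy : 0 ≤ y := by linarith
  have h : x ^ k * x ≤ y ^ k * (y - 1) := by
    gcongr
    linarith
  rw [pow_succ, pow_succ]
  linarith

theorem stmt_9 (f : ℕ → ℝ) (c : ℝ) (hc : 0 ≤ c) (k : ℕ)
    (hrec : ∀ n : ℕ, n ≥ 2 → f n ≤ c * (Real.logb 2 n) ^ k + f (n / 2)) :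
    ∀ n : ℕ, n ≥ 1 → f n ≤ f 1 + c * (Real.logb 2 n) ^ (k + 1) := by
  intro n
  induction n using Nat.strong_induction_on with
  | _ n ih =>
    intro hn
    rcases hn.eq_or_lt with rfl | hn2
    · simp
    · have hhalf : 1 ≤ n / 2 := Nat.div_pos hn2 two_pos
      have hlog : 0 ≤ Real.logb 2 (n / 2 : ℕ) :=
        Real.logb_nonneg one_lt_two (by exact_mod_cast hhalf)
      have hstep := mul_le_mul_of_nonneg_left
        (pow_add_pow_succ_le hlog (logb_two_nat_div_two_le hn2) k) hc
      linarith [hrec n hn2, ih (n / 2) (by omega) hhalf]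
end
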